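/- Let a, b be integers with a < 0 or b < 0, and set k = min(a,b). Then H^{m,n}(G_D(a,b)) = 0 whenever m > 0, and also whenever m = 0 and n > k; and for m = 0 and n ≤ k, H^{0,n}(G_D(a,b)) is a ℂ-vector space of dimension binom(2, a+b−n) (in particular zero unless 0 ≤ a+b−n ≤ 2). -/

import Mathlib

/- Setup: `Ex = ⋀(ℂ⁴)` is the exterior algebra on generators `f 0, f 1, f 2, f 3`
(`f 0, f 1` the "plus" generators, `f 2, f 3` the "minus" generators); `lamPM k b`
is `Λ₊ᵏ∧Λ₋ᵇ` (zero for indices outside `{0,1,2}`).  `G_D = Ex ⊗ ℂ[x₁,x₂,v₁,v₂]`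
(variables `X 0, X 1 = x₁, x₂` and `X 2, X 3 = v₁, v₂`) with differential
`∇(ω⊗p) = (f₁∧ω)⊗v₁∂ₓ₁p + (f₂∧ω)⊗v₁∂ₓ₂p + (f₃∧ω)⊗v₂∂ₓ₁p + (f₄∧ω)⊗v₂∂ₓ₂p`.
`GD a b m n` is the bigraded piece `G_D(a,b)^{m,n}` spanned by the
`ω ⊗ q·v₁ʳv₂ˢ` with `ω ∈ Λ₊^{a+r}∧Λ₋^{b+s}`, `q` homogeneous of degree `m` in
`x₁,x₂`, and `r+s = −n`. -/

set_option synthInstance.maxHeartbeats 1000000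
set_option maxHeartbeats 1000000

noncomputable section

open scoped TensorProduct

abbrev Ex : Type := ExteriorAlgebra ℂ (Fin 4 → ℂ)

def f (i : Fin 4) : Ex := ExteriorAlgebra.ι ℂ (Pi.single i 1)

/-- `Λ₊ᵏ∧Λ₋ᵇ` for integer indices (zero when `k < 0` or `b < 0`). -/
def lamPM (k b : ℤ) : Submodule ℂ Ex :=
  Submodule.span ℂ {x | ∃ lp lm : List (Fin 2), (lp.length : ℤ) = k ∧ (lm.length : ℤ) = b ∧
    x = (lp.map (fun i : Fin 2 => f ⟨i.1, by have := i.2; omega⟩)).prod *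
        (lm.map (fun i : Fin 2 => f ⟨i.1 + 2, by have := i.2; omega⟩)).prod}

abbrev P4 : Type := MvPolynomial (Fin 4) ℂ

abbrev MEx : Type := Ex ⊗[ℂ] P4

instance : AddCommGroup MEx := inferInstance
instance : Module ℂ MEx := inferInstance

def pd (i : Fin 4) : P4 →ₗ[ℂ] P4 := (MvPolynomial.pderiv i).toLinearMap

/-- the inclusion of the `x`-variables -/
def xin : Fin 2 → Fin 4 := fun i => ⟨i.1, by have := i.2; omega⟩

/-- `∇(ω⊗p) = (f₁∧ω)⊗v₁∂ₓ₁p + (f₂∧ω)⊗v₁∂ₓ₂p + (f₃∧ω)⊗v₂∂ₓ₁p + (f₄∧ω)⊗v₂∂ₓ₂p` -/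
def nabla : MEx →ₗ[ℂ] MEx :=
  TensorProduct.map (LinearMap.mulLeft ℂ (f 0)) (LinearMap.mulLeft ℂ (MvPolynomial.X 2 : P4) ∘ₗ pd 0) +
  TensorProduct.map (LinearMap.mulLeft ℂ (f 1)) (LinearMap.mulLeft ℂ (MvPolynomial.X 2 : P4) ∘ₗ pd 1) +
  TensorProduct.map (LinearMap.mulLeft ℂ (f 2)) (LinearMap.mulLeft ℂ (MvPolynomial.X 3 : P4) ∘ₗ pd 0) +
  TensorProduct.map (LinearMap.mulLeft ℂ (f 3)) (LinearMap.mulLeft ℂ (MvPolynomial.X 3 : P4) ∘ₗ pd 1)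

/-- The bigraded piece `G_D(a,b)^{m,n}` (of `x`-degree `m` and total `v`-degree `−n`). -/
def GD (a b m n : ℤ) : Submodule ℂ MEx :=
  Submodule.span ℂ {z | ∃ (r s d : ℕ) (ω : Ex) (q : MvPolynomial (Fin 2) ℂ),
    ω ∈ lamPM (a + r) (b + s) ∧ q.IsHomogeneous d ∧ (d : ℤ) = m ∧ ((r : ℤ) + s = -n) ∧
    z = ω ⊗ₜ (MvPolynomial.rename xin q * MvPolynomial.X 2 ^ r * MvPolynomial.X 3 ^ s)}

/-- `binom(2, n)` for an integer `n`, interpreted as `0` when `n < 0`. -/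
def zbinom (n : ℤ) : ℕ := if 0 ≤ n then Nat.choose 2 n.toNat else 0

def fp (i : Fin 2) : Ex := f ⟨i.1, by have := i.2; omega⟩
def fm (i : Fin 2) : Ex := f ⟨i.1 + 2, by have := i.2; omega⟩

def AA (lp lm : List (Fin 2)) : Ex := (lp.map fp).prod * (lm.map fm).prod

theorem lamPM_eq (k b : ℤ) : lamPM k b = Submodule.span ℂ {x | ∃ lp lm : List (Fin 2),
    (lp.length : ℤ) = k ∧ (lm.length : ℤ) = b ∧ x = AA lp lm} := rfl

theorem AA_cons (i : Fin 2) (lp lm : List (Fin 2)) : AA (i :: lp) lm = fp i * AA lp lm := by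
  simp [AA, mul_assoc]

theorem AA_mem (lp lm : List (Fin 2)) : AA lp lm ∈ lamPM lp.length lm.length := by
  rw [lamPM_eq]
  exact Submodule.subset_span ⟨lp, lm, rfl, rfl, rfl⟩

theorem AA_mem' (lp lm : List (Fin 2)) {k b : ℤ} (h1 : (lp.length : ℤ) = k)
    (h2 : (lm.length : ℤ) = b) : AA lp lm ∈ lamPM k b := by
  subst h1 h2
  exact AA_mem lp lm

/-- induction principle for `lamPM` -/
theorem lamPM_le {k b : ℤ} {T : Submodule ℂ Ex}
    (h : ∀ lp lm : List (Fin 2), (lp.length : ℤ) = k → (lm.length : ℤ) = b → AA lp lm ∈ T) :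
    lamPM k b ≤ T := by
  rw [lamPM_eq, Submodule.span_le]
  rintro x ⟨lp, lm, h1, h2, rfl⟩
  exact h lp lm h1 h2

theorem lamPM_neg_left {k b : ℤ} (hk : k < 0) : lamPM k b = ⊥ := by
  rw [eq_bot_iff]
  exact lamPM_le fun lp lm h1 h2 => by omega

theorem lamPM_neg_right {k b : ℤ} (hk : b < 0) : lamPM k b = ⊥ := by
  rw [eq_bot_iff]
  exact lamPM_le fun lp lm h1 h2 => by omega

theorem fp_mul_mem {k b : ℤ} (i : Fin 2) {ω : Ex} (h : ω ∈ lamPM k b) :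
    fp i * ω ∈ lamPM (k + 1) b := by
  have : lamPM k b ≤ (lamPM (k + 1) b).comap (LinearMap.mulLeft ℂ (fp i)) := by
    refine lamPM_le fun lp lm h1 h2 => ?_
    simp only [Submodule.mem_comap, LinearMap.mulLeft_apply]
    rw [← AA_cons]
    exact AA_mem' _ _ (by simp [h1]) h2
  exact this h

theorem f_swap (i j : Fin 4) : f i * f j = - (f j * f i) :=
  eq_neg_of_add_eq_zero_left (ExteriorAlgebra.ι_add_mul_swap _ _)

theorem fm_fp (i j : Fin 2) : fm i * fp j = - (fp j * fm i) := f_swap _ _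

theorem fp_fp (i j : Fin 2) : fp i * fp j = - (fp j * fp i) := f_swap _ _

theorem fm_mul_AA (i : Fin 2) (lp lm : List (Fin 2)) :
    fm i * AA lp lm ∈ lamPM lp.length (lm.length + 1) := by
  induction lp with
  | nil =>
    have : fm i * AA [] lm = AA [] (i :: lm) := by simp [AA]
    rw [this]
    exact AA_mem' _ _ (by simp) (by simp)
  | cons j lp ih =>
    rw [AA_cons, ← mul_assoc, fm_fp, neg_mul, mul_assoc]
    refine Submodule.neg_mem _ ?_
    have := fp_mul_mem j ih
    simpa using this

theorem fm_mul_mem {k b : ℤ} (i : Fin 2) {ω : Ex} (h : ω ∈ lamPM k b) :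
    fm i * ω ∈ lamPM k (b + 1) := by
  have : lamPM k b ≤ (lamPM k (b + 1)).comap (LinearMap.mulLeft ℂ (fm i)) := by
    refine lamPM_le fun lp lm h1 h2 => ?_
    simp only [Submodule.mem_comap, LinearMap.mulLeft_apply]
    rw [← h1, ← h2]
    exact fm_mul_AA i lp lm
  exact this h

/-- contraction with the dual of `fp j` -/
def io (j : Fin 2) : Ex →ₗ[ℂ] Ex :=
  CliffordAlgebra.contractLeft (LinearMap.proj (xin j) : (Fin 4 → ℂ) →ₗ[ℂ] ℂ)

theorem io_f (j : Fin 2) (i : Fin 4) (ω : Ex) :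
    io j (f i * ω) = (if xin j = i then (1 : ℂ) else 0) • ω - f i * io j ω := by
  have := CliffordAlgebra.contractLeft_ι_mul (Q := (0 : QuadraticForm ℂ (Fin 4 → ℂ)))
    (d := (LinearMap.proj (xin j) : (Fin 4 → ℂ) →ₗ[ℂ] ℂ)) (Pi.single i 1) ω
  refine Eq.trans this ?_
  simp only [LinearMap.proj_apply, Pi.single_apply]
  rfl

theorem io_fp (j i : Fin 2) (ω : Ex) :
    io j (fp i * ω) = (if j = i then (1 : ℂ) else 0) • ω - fp i * io j ω := by
  have := io_f j (xin i) ω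
  have h : (xin j = xin i) ↔ j = i := by simp [xin, Fin.ext_iff]
  simp only [h] at this
  exact this

theorem io_fm (j i : Fin 2) (ω : Ex) :
    io j (fm i * ω) = - (fm i * io j ω) := by
  have := io_f j ⟨i.1 + 2, by have := i.2; omega⟩ ω
  have h : ¬ (xin j = ⟨i.1 + 2, by have := i.2; omega⟩) := by
    have := j.2
    simp only [xin, Fin.ext_iff]; omega
  simp only [h, if_false, zero_smul, zero_sub] at this
  exact this

theorem io_AA_nil (j : Fin 2) (lm : List (Fin 2)) : io j (AA [] lm) = 0 := by
  induction lm with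
  | nil =>
    have : AA [] [] = 1 := by simp [AA]
    rw [this]
    exact CliffordAlgebra.contractLeft_one (Q := (0 : QuadraticForm ℂ (Fin 4 → ℂ)))
      (d := (LinearMap.proj (xin j) : (Fin 4 → ℂ) →ₗ[ℂ] ℂ))
  | cons i lm ih =>
    have : AA [] (i :: lm) = fm i * AA [] lm := by simp [AA]
    rw [this, io_fm, ih, mul_zero, neg_zero]

theorem io_zero {k b : ℤ} (hk : k ≤ 0) (j : Fin 2) {ω : Ex} (h : ω ∈ lamPM k b) :
    io j ω = 0 := by
  have : lamPM k b ≤ LinearMap.ker (io j) := by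
    refine lamPM_le fun lp lm h1 h2 => ?_
    have : lp = [] := by
      apply List.eq_nil_of_length_eq_zero; omega
    subst this
    exact io_AA_nil j lm
  exact this h

theorem io_AA (j : Fin 2) (lp lm : List (Fin 2)) :
    io j (AA lp lm) ∈ lamPM (lp.length - 1) lm.length := by
  induction lp with
  | nil => rw [io_AA_nil]; exact Submodule.zero_mem _
  | cons i lp ih =>
    rw [AA_cons, io_fp]
    refine Submodule.sub_mem _ (Submodule.smul_mem _ _ (AA_mem' _ _ (by simp) rfl)) ?_
    have := fp_mul_mem i ih
    simpa using this

theorem io_mem {k b : ℤ} (j : Fin 2) {ω : Ex} (h : ω ∈ lamPM k b) :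
    io j ω ∈ lamPM (k - 1) b := by
  have : lamPM k b ≤ (lamPM (k - 1) b).comap (io j) := by
    refine lamPM_le fun lp lm h1 h2 => ?_
    rw [← h1, ← h2]
    exact io_AA j lp lm
  exact this h

theorem number_AA (lp lm : List (Fin 2)) :
    fp 0 * io 0 (AA lp lm) + fp 1 * io 1 (AA lp lm) = (lp.length : ℂ) • AA lp lm := by
  induction lp with
  | nil => simp [io_AA_nil]
  | cons i lp ih =>
    rw [AA_cons, io_fp, io_fp, mul_sub, mul_sub, ← mul_assoc, ← mul_assoc, fp_fp 0 i, fp_fp 1 i]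
    have h : fp i * (fp 0 * io 0 (AA lp lm) + fp 1 * io 1 (AA lp lm)) =
      fp i * ((lp.length : ℂ) • AA lp lm) := by rw [ih]
    rw [mul_add, ← mul_assoc, ← mul_assoc, mul_smul_comm] at h
    have h2 : fp 0 * ((if (0 : Fin 2) = i then (1 : ℂ) else 0) • AA lp lm) +
      fp 1 * ((if (1 : Fin 2) = i then (1 : ℂ) else 0) • AA lp lm) = fp i * AA lp lm := by
      fin_cases i <;> simp
    simp only [List.length_cons, Nat.cast_add, Nat.cast_one, add_smul, one_smul]
    rw [← h, ← h2]
    simp only [neg_mul]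
    abel

theorem number_mem {k b : ℤ} {ω : Ex} (h : ω ∈ lamPM k b) :
    fp 0 * io 0 ω + fp 1 * io 1 ω = (k : ℂ) • ω := by
  have : lamPM k b ≤ LinearMap.ker (LinearMap.mulLeft ℂ (fp 0) ∘ₗ io 0 +
      LinearMap.mulLeft ℂ (fp 1) ∘ₗ io 1 - (k : ℂ) • LinearMap.id) := by
    refine lamPM_le fun lp lm h1 h2 => ?_
    have := number_AA lp lm
    simp only [LinearMap.mem_ker, LinearMap.sub_apply, LinearMap.add_apply, LinearMap.comp_apply,
      LinearMap.mulLeft_apply, LinearMap.smul_apply, LinearMap.id_apply]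
    rw [this, ← h1, Int.cast_natCast, sub_self]
  have := this h
  simp only [LinearMap.mem_ker, LinearMap.sub_apply, LinearMap.add_apply, LinearMap.comp_apply,
      LinearMap.mulLeft_apply, LinearMap.smul_apply, LinearMap.id_apply] at this
  exact sub_eq_zero.mp this

/-- the polynomial attached to `q`, `r`, `s` -/
def PP (q : MvPolynomial (Fin 2) ℂ) (r s : ℕ) : P4 :=
  MvPolynomial.rename xin q * MvPolynomial.X 2 ^ r * MvPolynomial.X 3 ^ s

theorem xin_inj : Function.Injective xin := by
  intro i j h
  simpa [xin, Fin.ext_iff] using h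

theorem nabla_tmul (ω : Ex) (p : P4) : nabla (ω ⊗ₜ p) =
    (fp 0 * ω) ⊗ₜ (MvPolynomial.X 2 * pd (xin 0) p) + (fp 1 * ω) ⊗ₜ (MvPolynomial.X 2 * pd (xin 1) p)
    + (fm 0 * ω) ⊗ₜ (MvPolynomial.X 3 * pd (xin 0) p)
    + (fm 1 * ω) ⊗ₜ (MvPolynomial.X 3 * pd (xin 1) p) := rfl

theorem pd_mul (i : Fin 4) (p q : P4) : pd i (p * q) = pd i p * q + p * pd i q :=
  MvPolynomial.pderiv_mul

theorem pd_X (i j : Fin 4) : pd i (MvPolynomial.X j) = if i = j then 1 else 0 := by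
  have := MvPolynomial.pderiv_X (R := ℂ) i j
  simp only [Pi.single_apply] at this
  refine Eq.trans this ?_
  simp [eq_comm]

theorem pd_X2 (i : Fin 2) (p : P4) :
    pd (xin i) (MvPolynomial.X 2 * p) = MvPolynomial.X 2 * pd (xin i) p := by
  rw [pd_mul, pd_X, if_neg (by fin_cases i <;> simp [xin]), zero_mul, zero_add]

theorem pd_X3 (i : Fin 2) (p : P4) :
    pd (xin i) (MvPolynomial.X 3 * p) = MvPolynomial.X 3 * pd (xin i) p := by
  rw [pd_mul, pd_X, if_neg (by fin_cases i <;> simp [xin]), zero_mul, zero_add]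

theorem pd_xx (i j : Fin 2) (p : P4) :
    pd (xin i) (MvPolynomial.X (xin j) * p) =
      (if i = j then p else 0) + MvPolynomial.X (xin j) * pd (xin i) p := by
  rw [pd_mul, pd_X]
  simp only [xin_inj.eq_iff]
  split_ifs <;> simp

theorem PP_succ (q : MvPolynomial (Fin 2) ℂ) (r s : ℕ) :
    PP q (r + 1) s = MvPolynomial.X 2 * PP q r s := by
  simp only [PP]; ring

theorem PP_succ' (q : MvPolynomial (Fin 2) ℂ) (r s : ℕ) :
    PP q r (s + 1) = MvPolynomial.X 3 * PP q r s := by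
  simp only [PP]; ring

theorem PP_X (j : Fin 2) (q : MvPolynomial (Fin 2) ℂ) (r s : ℕ) :
    PP (MvPolynomial.X j * q) r s = MvPolynomial.X (xin j) * PP q r s := by
  simp only [PP, map_mul, MvPolynomial.rename_X]; ring

theorem pd_PP (i : Fin 2) (q : MvPolynomial (Fin 2) ℂ) (r s : ℕ) :
    pd (xin i) (PP q r s) = PP (MvPolynomial.pderiv i q) r s := by
  induction r with
  | succ r ih => rw [PP_succ, pd_X2, ih, PP_succ]
  | zero =>
    induction s with
    | succ s ih => rw [PP_succ', pd_X3, ih, PP_succ']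
    | zero =>
      simp only [PP, pow_zero, mul_one]
      exact MvPolynomial.pderiv_rename xin_inj i q

theorem euler_PP {d : ℕ} {q : MvPolynomial (Fin 2) ℂ} (hq : q.IsHomogeneous d) (r s : ℕ) :
    MvPolynomial.X (xin 0) * pd (xin 0) (PP q r s) + MvPolynomial.X (xin 1) * pd (xin 1) (PP q r s)
      = (d : ℂ) • PP q r s := by
  rw [pd_PP, pd_PP, ← PP_X, ← PP_X]
  have := hq.sum_X_mul_pderiv
  rw [Fin.sum_univ_two] at this
  have h2 : ∀ u v, PP u r s + PP v r s = PP (u + v) r s := by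
    intro u v; simp only [PP, map_add]; ring
  rw [h2, this, ← Nat.cast_smul_eq_nsmul ℂ]
  simp only [PP, map_smul, smul_mul_assoc]

theorem exists_D : ∃ D : P4 →ₗ[ℂ] P4, ∀ p, D (MvPolynomial.X 2 * p) = p := by
  have hinj : LinearMap.ker (LinearMap.mulLeft ℂ (MvPolynomial.X 2 : P4)) = ⊥ := by
    rw [LinearMap.ker_eq_bot]
    intro p q h
    exact mul_left_cancel₀ (MvPolynomial.X_ne_zero (R := ℂ) (2 : Fin 4)) h
  obtain ⟨D, hD⟩ := LinearMap.exists_leftInverse_of_injective _ hinj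
  exact ⟨D, fun p => LinearMap.congr_fun hD p⟩

def DD : P4 →ₗ[ℂ] P4 := exists_D.choose

theorem DD_X (p : P4) : DD (MvPolynomial.X 2 * p) = p := exists_D.choose_spec p

/-- the homotopy -/
def KK : MEx →ₗ[ℂ] MEx :=
  TensorProduct.map (io 0) (LinearMap.mulLeft ℂ (MvPolynomial.X (xin 0) : P4) ∘ₗ DD) +
  TensorProduct.map (io 1) (LinearMap.mulLeft ℂ (MvPolynomial.X (xin 1) : P4) ∘ₗ DD)

theorem KK_tmul (ω : Ex) (p : P4) : KK (ω ⊗ₜ p) =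
    io 0 ω ⊗ₜ (MvPolynomial.X (xin 0) * DD p) + io 1 ω ⊗ₜ (MvPolynomial.X (xin 1) * DD p) := rfl

theorem GD_eq (a b m n : ℤ) : GD a b m n =
  Submodule.span ℂ {z | ∃ (r s d : ℕ) (ω : Ex) (q : MvPolynomial (Fin 2) ℂ),
    ω ∈ lamPM (a + r) (b + s) ∧ q.IsHomogeneous d ∧ (d : ℤ) = m ∧ ((r : ℤ) + s = -n) ∧
    z = ω ⊗ₜ PP q r s} := rfl

theorem GD_mem {a b m n : ℤ} (r s d : ℕ) {ω : Ex} {q : MvPolynomial (Fin 2) ℂ} {k l : ℤ}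
    (hω : ω ∈ lamPM k l) (hk : k = a + r) (hl : l = b + s) (hq : q.IsHomogeneous d)
    (hd : (d : ℤ) = m) (hn : (r : ℤ) + s = -n) : ω ⊗ₜ PP q r s ∈ GD a b m n := by
  subst hk hl
  exact Submodule.subset_span ⟨r, s, d, ω, q, hω, hq, hd, hn, rfl⟩

theorem GD_le {a b m n : ℤ} {T : Submodule ℂ MEx}
    (h : ∀ (r s d : ℕ) (ω : Ex) (q : MvPolynomial (Fin 2) ℂ),
      ω ∈ lamPM (a + r) (b + s) → q.IsHomogeneous d → (d : ℤ) = m → ((r : ℤ) + s = -n) →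
      ω ⊗ₜ PP q r s ∈ T) : GD a b m n ≤ T := by
  rw [GD_eq, Submodule.span_le]
  rintro z ⟨r, s, d, ω, q, h1, h2, h3, h4, rfl⟩
  exact h r s d ω q h1 h2 h3 h4

/-- filtered pieces -/
def FD (j : ℕ) (a b m n : ℤ) : Submodule ℂ MEx :=
  Submodule.span ℂ {z | ∃ (r s d : ℕ) (ω : Ex) (q : MvPolynomial (Fin 2) ℂ),
    ω ∈ lamPM (a + r) (b + s) ∧ q.IsHomogeneous d ∧ (d : ℤ) = m ∧ ((r : ℤ) + s = -n) ∧
    a + r < j ∧ z = ω ⊗ₜ PP q r s}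

theorem FD_mem {a b m n : ℤ} (j r s d : ℕ) {ω : Ex} {q : MvPolynomial (Fin 2) ℂ} {k l : ℤ}
    (hω : ω ∈ lamPM k l) (hk : k = a + r) (hl : l = b + s) (hq : q.IsHomogeneous d)
    (hd : (d : ℤ) = m) (hn : (r : ℤ) + s = -n) (hj : k < j) : ω ⊗ₜ PP q r s ∈ FD j a b m n := by
  subst hk hl
  exact Submodule.subset_span ⟨r, s, d, ω, q, hω, hq, hd, hn, hj, rfl⟩

theorem FD_le_GD (j : ℕ) (a b m n : ℤ) : FD j a b m n ≤ GD a b m n := by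
  rw [FD, Submodule.span_le]
  rintro z ⟨r, s, d, ω, q, h1, h2, h3, h4, h5, rfl⟩
  exact GD_mem r s d h1 rfl rfl h2 h3 h4

theorem GD_le_FD (a b m n : ℤ) : GD a b m n ≤ FD (a - n + 1).toNat a b m n :=
  GD_le fun r s d ω q h1 h2 h3 h4 =>
    FD_mem _ r s d h1 rfl rfl h2 h3 h4 (by omega)

theorem FD_zero (a b m n : ℤ) : FD 0 a b m n = ⊥ := by
  rw [eq_bot_iff, FD, Submodule.span_le]
  rintro z ⟨r, s, d, ω, q, h1, h2, h3, h4, h5, rfl⟩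
  rw [lamPM_neg_left (by simpa using h5)] at h1
  rw [(Submodule.mem_bot ℂ).mp h1, TensorProduct.zero_tmul]
  exact Submodule.zero_mem _

theorem KK_mem {a b m n : ℤ} (ha : a ≤ 0) {z : MEx} (hz : z ∈ GD a b m n) :
    KK z ∈ GD a b (m + 1) (n + 1) := by
  have : GD a b m n ≤ (GD a b (m + 1) (n + 1)).comap KK := by
    refine GD_le fun r s d ω q h1 h2 h3 h4 => ?_
    rw [Submodule.mem_comap, KK_tmul]
    rcases r with _ | r
    · rw [io_zero (by simpa using ha) 0 h1, io_zero (by simpa using ha) 1 h1]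
      simp
    · rw [PP_succ, DD_X, ← PP_X, ← PP_X]
      have hX : ∀ j : Fin 2, (MvPolynomial.X j * q).IsHomogeneous (d + 1) := fun j => by
        rw [add_comm]; exact (MvPolynomial.isHomogeneous_X ℂ j).mul h2
      refine Submodule.add_mem _ ?_ ?_
      · exact GD_mem r s (d + 1) (io_mem 0 h1) (by push_cast; ring) rfl (hX 0)
          (by push_cast; omega) (by push_cast at h4; omega)
      · exact GD_mem r s (d + 1) (io_mem 1 h1) (by push_cast; ring) rfl (hX 1)
          (by push_cast; omega) (by push_cast at h4; omega)
  exact this hz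

theorem homotopy_gen {p l : ℤ} {r s d : ℕ} {ω : Ex} {q : MvPolynomial (Fin 2) ℂ}
    (h1 : ω ∈ lamPM p l) (h2 : q.IsHomogeneous d) :
    nabla (KK (ω ⊗ₜ PP q (r + 1) s)) + KK (nabla (ω ⊗ₜ PP q (r + 1) s)) =
      ((d : ℂ) + p) • (ω ⊗ₜ[ℂ] PP q (r + 1) s) +
      ((fm 0 * io 0 ω) ⊗ₜ PP q r (s + 1) + (fm 1 * io 1 ω) ⊗ₜ PP q r (s + 1)) := by
  have hE := euler_PP h2 (r + 1) s
  have hN := number_mem h1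
  rw [add_smul, ← TensorProduct.tmul_smul, ← hE, TensorProduct.smul_tmul', ← hN, PP_succ, PP_succ']
  generalize PP q r s = P
  have c2 : ∀ (j : Fin 2) (A : P4), MvPolynomial.X 2 * (MvPolynomial.X (xin j) * A) =
    MvPolynomial.X (xin j) * (MvPolynomial.X 2 * A) := fun j A => by ring
  have c3 : ∀ (j : Fin 2) (A : P4), MvPolynomial.X 3 * (MvPolynomial.X (xin j) * A) =
    MvPolynomial.X (xin j) * (MvPolynomial.X 3 * A) := fun j A => by ring
  have c4 : ∀ (A : P4), MvPolynomial.X 3 * (MvPolynomial.X 2 * A) =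
    MvPolynomial.X 2 * (MvPolynomial.X 3 * A) := fun A => by ring
  simp only [KK_tmul, nabla_tmul, map_add, pd_X2, DD_X, pd_xx, io_fp, io_fm, if_true,
    mul_add, TensorProduct.tmul_add, TensorProduct.add_tmul, TensorProduct.sub_tmul,
    TensorProduct.neg_tmul, c2, c3, c4, one_smul, zero_smul, TensorProduct.zero_tmul,
    TensorProduct.tmul_zero, mul_zero, show (0 : Fin 2) ≠ 1 from by decide,
    show (1 : Fin 2) ≠ 0 from by decide, if_false]
  abel

theorem homotopy_gen0 {p l : ℤ} {r s d : ℕ} {ω : Ex} {q : MvPolynomial (Fin 2) ℂ} (hp : p ≤ 0)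
    (h1 : ω ∈ lamPM p l) (h2 : q.IsHomogeneous d) :
    nabla (KK (ω ⊗ₜ PP q r s)) + KK (nabla (ω ⊗ₜ PP q r s)) =
      ((d : ℂ) + p) • (ω ⊗ₜ[ℂ] PP q r s) := by
  have hE := euler_PP h2 r s
  have hN := number_mem h1
  rw [add_smul, ← TensorProduct.tmul_smul, ← hE, TensorProduct.smul_tmul', ← hN]
  have i0 := io_zero hp 0 h1
  have i1 := io_zero hp 1 h1
  generalize PP q r s = P
  simp only [KK_tmul, nabla_tmul, map_add, DD_X, io_fp, io_fm, if_true, i0, i1,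
    TensorProduct.tmul_add, TensorProduct.add_tmul, TensorProduct.sub_tmul,
    TensorProduct.neg_tmul, one_smul, zero_smul, TensorProduct.zero_tmul,
    mul_zero, show (0 : Fin 2) ≠ 1 from by decide,
    show (1 : Fin 2) ≠ 0 from by decide, if_false]
  simp only [neg_zero, sub_zero, add_zero, zero_add, map_zero]

theorem homotopy_FD {j : ℕ} {a b m n : ℤ} (ha : a ≤ 0) {z : MEx}
    (hz : z ∈ FD (j + 1) a b m n) :
    ((m : ℂ) + j) • z - (nabla (KK z) + KK (nabla z)) ∈ FD j a b m n := by
  have : FD (j + 1) a b m n ≤ (FD j a b m n).comap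
      (((m : ℂ) + j) • LinearMap.id - (nabla ∘ₗ KK + KK ∘ₗ nabla)) := by
    rw [FD, Submodule.span_le]
    rintro z ⟨r, s, d, ω, q, h1, h2, h3, h4, h5, rfl⟩
    simp only [SetLike.mem_coe, Submodule.mem_comap, LinearMap.sub_apply, LinearMap.add_apply,
      LinearMap.comp_apply, LinearMap.smul_apply, LinearMap.id_apply]
    have hmd : (m : ℂ) = d := by rw [← h3]; simp
    have key : ((j : ℂ) - ((a + r : ℤ) : ℂ)) • (ω ⊗ₜ[ℂ] PP q r s) ∈ FD j a b m n := by
      by_cases hj : a + r = j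
      · rw [hj]; simp
      · exact Submodule.smul_mem _ _ (FD_mem j r s d h1 rfl rfl h2 h3 h4 (by push_cast at h5; omega))
    rcases r with _ | r
    · rw [homotopy_gen0 (by simpa using ha) h1 h2, ← sub_smul, hmd]
      convert key using 2
      ring
    · rw [homotopy_gen h1 h2, ← sub_sub, ← sub_smul, hmd]
      refine Submodule.sub_mem _ ?_ (Submodule.add_mem _ ?_ ?_)
      · convert key using 2
        ring
      · exact FD_mem j r (s + 1) d (fm_mul_mem 0 (io_mem 0 h1)) (by push_cast; ring)
          (by push_cast; ring) h2 h3 (by push_cast at h4 ⊢; omega) (by push_cast at h5 ⊢; omega)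
      · exact FD_mem j r (s + 1) d (fm_mul_mem 1 (io_mem 1 h1)) (by push_cast; ring)
          (by push_cast; ring) h2 h3 (by push_cast at h4 ⊢; omega) (by push_cast at h5 ⊢; omega)
  exact this hz

theorem nabla_sq (z : MEx) : nabla (nabla z) = 0 := by
  have : nabla ∘ₗ nabla = 0 := by
    refine TensorProduct.ext' fun ω p => ?_
    rw [LinearMap.comp_apply, LinearMap.zero_apply]
    have hc : pd (xin 1) (pd (xin 0) p) = pd (xin 0) (pd (xin 1) p) := by
      have h0 : ⁅MvPolynomial.pderiv (R := ℂ) (xin 1), MvPolynomial.pderiv (R := ℂ) (xin 0)⁆ = 0 := by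
        refine MvPolynomial.derivation_ext fun i => ?_
        rw [Derivation.commutator_apply]
        simp only [MvPolynomial.pderiv_X, Pi.single_apply, Derivation.coe_zero, Pi.zero_apply]
        split_ifs <;> simp
      have h1 := Derivation.congr_fun h0 p
      rw [Derivation.commutator_apply] at h1
      exact sub_eq_zero.mp h1
    have hsq : ∀ (i : Fin 4) (x : Ex), f i * (f i * x) = 0 := fun i x => by
      rw [← mul_assoc, f, ExteriorAlgebra.ι_sq_zero, zero_mul]
    have s1 : ∀ (i : Fin 2) (x : Ex), fp i * (fp i * x) = 0 := fun i x => hsq _ x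
    have s2 : ∀ (i : Fin 2) (x : Ex), fm i * (fm i * x) = 0 := fun i x => hsq _ x
    have s3 : ∀ (x : Ex), fp 1 * (fp 0 * x) = - (fp 0 * (fp 1 * x)) := fun x => by
      rw [← mul_assoc, fp_fp, neg_mul, mul_assoc]
    have s4 : ∀ (x : Ex), fm 1 * (fm 0 * x) = - (fm 0 * (fm 1 * x)) := fun x => by
      rw [← mul_assoc, show fm 1 * fm 0 = - (fm 0 * fm 1) from f_swap _ _, neg_mul, mul_assoc]
    have s5 : ∀ (i j : Fin 2) (x : Ex), fm i * (fp j * x) = - (fp j * (fm i * x)) := fun i j x => by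
      rw [← mul_assoc, fm_fp, neg_mul, mul_assoc]
    have c4 : ∀ (A : P4), MvPolynomial.X 3 * (MvPolynomial.X 2 * A) =
      MvPolynomial.X 2 * (MvPolynomial.X 3 * A) := fun A => by ring
    simp only [nabla_tmul, map_add, pd_X2, pd_X3, s1, s2, s3, s4, s5, hc, c4,
      TensorProduct.zero_tmul, TensorProduct.neg_tmul]
    abel
  exact LinearMap.congr_fun this z

theorem exact_pos {a b m n : ℤ} (ha : a ≤ 0) (hm : 0 < m) (j : ℕ) : ∀ z ∈ FD j a b m n,
    nabla z = 0 → z ∈ Submodule.map nabla (GD a b (m + 1) (n + 1)) := by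
  induction j with
  | zero =>
    intro z hz _
    rw [FD_zero, Submodule.mem_bot] at hz
    rw [hz]; exact Submodule.zero_mem _
  | succ j ih =>
    intro z hz h0
    have h1 := homotopy_FD ha hz
    rw [h0, map_zero, add_zero] at h1
    have h2 := ih _ h1 (by rw [map_sub, map_smul, h0, nabla_sq, smul_zero, sub_zero])
    have h3 : nabla (KK z) ∈ Submodule.map nabla (GD a b (m + 1) (n + 1)) :=
      Submodule.mem_map_of_mem (KK_mem ha (FD_le_GD _ _ _ _ _ hz))
    have h4 := Submodule.add_mem _ h2 h3
    rw [sub_add_cancel] at h4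
    have hne : ((m : ℂ) + j) ≠ 0 := by
      have : ((m + j : ℤ) : ℂ) ≠ 0 := by
        rw [Int.cast_ne_zero]; omega
      simpa using this
    exact (Submodule.smul_mem_iff _ hne).mp h4

theorem partA {a b m n : ℤ} (ha : a ≤ 0) (hm : 0 < m) :
    GD a b m n ⊓ LinearMap.ker nabla ≤ Submodule.map nabla (GD a b (m + 1) (n + 1)) := by
  rintro z ⟨h1, h2⟩
  exact exact_pos ha hm _ z (GD_le_FD a b m n h1) h2

abbrev Ex2 : Type := ExteriorAlgebra ℂ (Fin 2 → ℂ)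

def ee (i : Fin 2) : Ex2 := ExteriorAlgebra.ι ℂ (Pi.single i 1)

def Lmap : (Fin 4 → ℂ) →ₗ[ℂ] (Fin 2 → ℂ) :=
  LinearMap.funLeft ℂ ℂ (fun i : Fin 2 => (⟨i.1 + 2, by have := i.2; omega⟩ : Fin 4)) -
    LinearMap.funLeft ℂ ℂ xin

def Mmap : (Fin 2 → ℂ) →ₗ[ℂ] (Fin 4 → ℂ) :=
  LinearMap.pi ![0, 0, LinearMap.proj 0, LinearMap.proj 1]

def phi : Ex →ₐ[ℂ] Ex2 := ExteriorAlgebra.map Lmap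
def psi : Ex2 →ₐ[ℂ] Ex := ExteriorAlgebra.map Mmap

theorem phi_fp (i : Fin 2) : phi (fp i) = - ee i := by
  rw [phi, fp, f, ExteriorAlgebra.map_apply_ι, ee, ← map_neg]
  congr 1
  ext j
  fin_cases i <;> fin_cases j <;> simp [Lmap, LinearMap.funLeft_apply, Pi.single_apply, xin]

theorem phi_fm (i : Fin 2) : phi (fm i) = ee i := by
  rw [phi, fm, f, ExteriorAlgebra.map_apply_ι, ee]
  congr 1
  ext j
  fin_cases i <;> fin_cases j <;> simp [Lmap, LinearMap.funLeft_apply, Pi.single_apply, xin]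

theorem psi_ee (i : Fin 2) : psi (ee i) = fm i := by
  rw [psi, fm, f, ee, ExteriorAlgebra.map_apply_ι]
  congr 1
  ext j
  fin_cases i <;> fin_cases j <;> simp [Mmap, Pi.single_apply]

theorem AA_nil_cons (i : Fin 2) (lm : List (Fin 2)) : AA [] (i :: lm) = fm i * AA [] lm := by
  simp [AA]

theorem psi_phi_AA (lm : List (Fin 2)) : psi (phi (AA [] lm)) = AA [] lm := by
  induction lm with
  | nil => simp [AA]
  | cons i lm ih => rw [AA_nil_cons, map_mul, map_mul, phi_fm, psi_ee, ih]

theorem psi_phi {k : ℤ} {ω : Ex} (h : ω ∈ lamPM 0 k) : psi (phi ω) = ω := by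
  have : lamPM 0 k ≤ LinearMap.ker ((psi.comp phi).toLinearMap - LinearMap.id) := by
    refine lamPM_le fun lp lm h1 h2 => ?_
    have : lp = [] := by
      apply List.eq_nil_of_length_eq_zero; omega
    subst this
    simp [psi_phi_AA]
  have := this h
  rw [LinearMap.mem_ker, LinearMap.sub_apply, sub_eq_zero] at this
  exact this

/-- the target of the comparison map -/
def WW (t : ℤ) : Submodule ℂ Ex2 := (lamPM 0 t).map phi.toLinearMap

theorem WW_nat (t : ℕ) : WW t = ⋀[ℂ]^t (Fin 2 → ℂ) := by
  change _ = (LinearMap.range (ExteriorAlgebra.ι ℂ : (Fin 2 → ℂ) →ₗ[ℂ] _)) ^ t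
  induction t with
  | zero =>
    rw [pow_zero, WW]
    apply le_antisymm
    · rw [Submodule.map_le_iff_le_comap]
      refine lamPM_le fun lp lm h1 h2 => ?_
      have e1 : lp = [] := by apply List.eq_nil_of_length_eq_zero; omega
      have e2 : lm = [] := by apply List.eq_nil_of_length_eq_zero; simpa using h2
      subst e1 e2
      simp only [AA, List.map_nil, List.prod_nil, mul_one, Submodule.mem_comap,
        AlgHom.toLinearMap_apply, map_one]
      exact Submodule.one_le.mp le_rfl
    · rw [Submodule.one_le]
      exact ⟨AA [] [], AA_mem' _ _ rfl rfl, by simp [AA]⟩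
  | succ t ih =>
    rw [pow_succ', ← ih]
    apply le_antisymm
    · rw [WW, Submodule.map_le_iff_le_comap]
      refine lamPM_le fun lp lm h1 h2 => ?_
      have e1 : lp = [] := by apply List.eq_nil_of_length_eq_zero; omega
      subst e1
      rcases lm with _ | ⟨i, lm⟩
      · simp at h2; omega
      · rw [Submodule.mem_comap, AlgHom.toLinearMap_apply, AA_nil_cons, map_mul, phi_fm]
        refine Submodule.mul_mem_mul ⟨_, rfl⟩ ?_
        exact ⟨AA [] lm, AA_mem' _ _ rfl (by simpa using h2), rfl⟩
    · rw [Submodule.mul_le]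
      rintro _ ⟨v, rfl⟩ _ ⟨ω, hω, rfl⟩
      have hv : ExteriorAlgebra.ι ℂ v = v 0 • ee 0 + v 1 • ee 1 := by
        rw [ee, ee, ← map_smul, ← map_smul, ← map_add]
        congr 1
        ext j
        fin_cases j <;> simp
      refine ⟨v 0 • (fm 0 * ω) + v 1 • (fm 1 * ω), ?_, ?_⟩
      · have := fun i => fm_mul_mem i hω
        push_cast
        exact Submodule.add_mem _ (Submodule.smul_mem _ _ (this 0)) (Submodule.smul_mem _ _ (this 1))
      · rw [hv]
        simp only [AlgHom.toLinearMap_apply, map_add, map_smul, map_mul, phi_fm, add_mul,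
          smul_mul_assoc]

theorem WW_equiv (t : ℤ) : Nonempty (↥(WW t) ≃ₗ[ℂ] (Fin (zbinom t) → ℂ)) := by
  rcases lt_or_ge t 0 with ht | ht
  · have h0 : WW t = ⊥ := by rw [WW, lamPM_neg_right ht, Submodule.map_bot]
    rw [h0, zbinom, if_neg (by omega)]
    exact ⟨LinearEquiv.ofFinrankEq _ _ (by simp)⟩
  · obtain ⟨t, rfl⟩ := Int.eq_ofNat_of_zero_le ht
    rw [zbinom, if_pos ht, WW_nat, Int.toNat_natCast]
    refine ⟨LinearEquiv.ofFinrankEq _ _ ?_⟩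
    rw [exteriorPower.finrank_eq]
    simp

def evP : P4 →ₐ[ℂ] ℂ := MvPolynomial.aeval ![0, 0, 1, 1]

/-- the comparison map -/
def pie : MEx →ₗ[ℂ] Ex2 :=
  TensorProduct.lift ((LinearMap.lsmul ℂ Ex2).flip.compl₁₂ phi.toLinearMap evP.toLinearMap)

theorem pie_tmul (ω : Ex) (p : P4) : pie (ω ⊗ₜ p) = evP p • phi ω := rfl

theorem pie_nabla (z : MEx) : pie (nabla z) = 0 := by
  have : pie ∘ₗ nabla = 0 := by
    refine TensorProduct.ext' fun ω p => ?_
    have e2 : evP (MvPolynomial.X 2) = 1 := by simp [evP]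
    have e3 : evP (MvPolynomial.X 3) = 1 := by simp [evP]
    rw [LinearMap.comp_apply, LinearMap.zero_apply, nabla_tmul]
    simp only [map_add, pie_tmul, map_mul, phi_fp, phi_fm, e2, e3, neg_mul, smul_neg]
    abel
  exact LinearMap.congr_fun this z

/-- representatives -/
def BB (a b n : ℤ) : Submodule ℂ MEx :=
  Submodule.span ℂ {z | ∃ (r s : ℕ) (ω : Ex), ω ∈ lamPM 0 (b + s) ∧ a + r = 0 ∧
    (r : ℤ) + s = -n ∧ z = ω ⊗ₜ PP 1 r s}

theorem decomp_aux (a b n : ℤ) (p : ℕ) : ∀ (r s : ℕ) (ω : Ex), ω ∈ lamPM p (b + s) →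
    a + r = p → (r : ℤ) + s = -n → a ≤ 0 →
    ω ⊗ₜ PP 1 r s ∈ Submodule.map nabla (GD a b 1 (n + 1)) ⊔ BB a b n := by
  induction p with
  | zero =>
    intro r s ω h1 h2 h3 _
    exact Submodule.mem_sup_right (Submodule.subset_span ⟨r, s, ω, by simpa using h1, by simpa using h2, h3, rfl⟩)
  | succ p ih =>
    intro r s ω h1 h2 h3 ha
    obtain ⟨r, rfl⟩ : ∃ r', r = r' + 1 := ⟨r - 1, by push_cast at h2; omega⟩
    have : lamPM ((p + 1 : ℕ) : ℤ) (b + s) ≤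
        (Submodule.map nabla (GD a b 1 (n + 1)) ⊔ BB a b n).comap
          ((TensorProduct.mk ℂ Ex P4).flip (PP 1 (r + 1) s)) := by
      refine lamPM_le fun lp lm e1 e2 => ?_
      rcases lp with _ | ⟨i, lp⟩
      · simp at e1; omega
      · rw [Submodule.mem_comap, LinearMap.flip_apply, TensorProduct.mk_apply, AA_cons]
        have hA : AA lp lm ∈ lamPM p (b + s) :=
          AA_mem' _ _ (by simpa using e1) e2
        have hg : AA lp lm ⊗ₜ PP (MvPolynomial.X i * 1) r s ∈ GD a b 1 (n + 1) :=
          GD_mem r s 1 hA (by push_cast at h2; omega) rfl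
            (by rw [mul_one]; exact MvPolynomial.isHomogeneous_X ℂ i) (by simp)
            (by push_cast at h3; omega)
        have hn : nabla (AA lp lm ⊗ₜ PP (MvPolynomial.X i * 1) r s) =
            (fp i * AA lp lm) ⊗ₜ PP 1 (r + 1) s + (fm i * AA lp lm) ⊗ₜ PP 1 r (s + 1) := by
          have h0 : ∀ j, pd (xin j) (PP 1 r s) = 0 := fun j => by
            rw [pd_PP, MvPolynomial.pderiv_one]; simp [PP]
          rw [nabla_tmul, PP_X, pd_xx, pd_xx, h0, h0, PP_succ, PP_succ']
          fin_cases i <;> simp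
        rw [← sub_eq_iff_eq_add] at hn
        rw [← hn]
        refine Submodule.sub_mem _ (Submodule.mem_sup_left (Submodule.mem_map_of_mem hg)) ?_
        exact ih r (s + 1) _ (by have := fm_mul_mem i hA; push_cast; rwa [← add_assoc])
          (by push_cast at h2; omega) (by push_cast at h3 ⊢; omega) ha
    exact this h1

theorem PP_zero {q : MvPolynomial (Fin 2) ℂ} (h : q.IsHomogeneous 0) (r s : ℕ) :
    ∃ c : ℂ, PP q r s = c • PP 1 r s := by
  rw [← MvPolynomial.totalDegree_zero_iff_isHomogeneous,
    MvPolynomial.totalDegree_eq_zero_iff_eq_C] at h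
  refine ⟨MvPolynomial.coeff 0 q, ?_⟩
  rw [h]
  simp [PP, MvPolynomial.C_mul', mul_assoc]

theorem decomp {a b n : ℤ} (ha : a ≤ 0) :
    GD a b 0 n ≤ Submodule.map nabla (GD a b 1 (n + 1)) ⊔ BB a b n := by
  refine GD_le fun r s d ω q h1 h2 h3 h4 => ?_
  have hd : d = 0 := by omega
  subst hd
  obtain ⟨c, hc⟩ := PP_zero h2 r s
  rw [hc, TensorProduct.tmul_smul]
  refine Submodule.smul_mem _ _ ?_
  rcases lt_or_ge (a + r) 0 with h | h
  · rw [lamPM_neg_left h, Submodule.mem_bot] at h1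
    rw [h1, TensorProduct.zero_tmul]
    exact Submodule.zero_mem _
  · obtain ⟨p, hp⟩ := Int.eq_ofNat_of_zero_le h
    rw [hp] at h1
    exact decomp_aux a b n p r s ω h1 hp h4 ha

theorem GD_ker {a b n : ℤ} : GD a b 0 n ≤ LinearMap.ker nabla := by
  refine GD_le fun r s d ω q h1 h2 h3 h4 => ?_
  have hd : d = 0 := by omega
  subst hd
  obtain ⟨c, hc⟩ := PP_zero h2 r s
  have h0 : ∀ j, pd (xin j) (PP 1 r s) = 0 := fun j => by
    rw [pd_PP, MvPolynomial.pderiv_one]; simp [PP]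
  rw [hc, LinearMap.mem_ker, TensorProduct.tmul_smul, map_smul, nabla_tmul, h0, h0]
  simp

theorem partB {a b n : ℤ} (ha : a ≤ 0) (hn : min a b < n) :
    GD a b 0 n ≤ Submodule.map nabla (GD a b 1 (n + 1)) := by
  have hB : BB a b n = ⊥ := by
    rw [eq_bot_iff, BB, Submodule.span_le]
    rintro z ⟨r, s, ω, h1, h2, h3, rfl⟩
    rw [lamPM_neg_right (by omega), Submodule.mem_bot] at h1
    rw [h1, TensorProduct.zero_tmul]
    exact Submodule.zero_mem _
  have := decomp (b := b) (n := n) ha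
  rwa [hB, sup_bot_eq] at this

theorem evP_PP (r s : ℕ) : evP (PP 1 r s) = 1 := by
  simp [evP, PP]

theorem partC {a b n : ℤ} (ha : a ≤ 0) (hn : n ≤ min a b) :
    ∃ π : MEx →ₗ[ℂ] Ex2,
      (∀ z ∈ GD a b 0 n, π z = 0 ↔ z ∈ Submodule.map nabla (GD a b 1 (n + 1))) ∧
      Submodule.map π (GD a b 0 n) = WW (a + b - n) := by
  obtain ⟨r, hr⟩ := Int.eq_ofNat_of_zero_le (show 0 ≤ -a by omega)
  obtain ⟨s, hs⟩ := Int.eq_ofNat_of_zero_le (show 0 ≤ a - n by omega)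
  have hB : ∀ z ∈ BB a b n, ∃ ω ∈ lamPM 0 (a + b - n), z = ω ⊗ₜ PP 1 r s := by
    have : BB a b n ≤ (lamPM 0 (a + b - n)).map ((TensorProduct.mk ℂ Ex P4).flip (PP 1 r s)) := by
      rw [BB, Submodule.span_le]
      rintro z ⟨r', s', ω, h1, h2, h3, rfl⟩
      obtain rfl : r' = r := by omega
      obtain rfl : s' = s := by omega
      exact ⟨ω, by rwa [show a + b - n = b + s' by omega], rfl⟩
    intro z hz
    obtain ⟨ω, h1, h2⟩ := this hz
    exact ⟨ω, h1, h2.symm⟩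
  have hz : ∀ z ∈ GD a b 0 n, ∃ y ∈ Submodule.map nabla (GD a b 1 (n + 1)),
      ∃ ω ∈ lamPM 0 (a + b - n), z = y + ω ⊗ₜ PP 1 r s ∧ pie z = phi ω := by
    intro z hz
    obtain ⟨y, hy, w, hw, rfl⟩ := Submodule.mem_sup.mp (decomp ha hz)
    obtain ⟨ω, h1, rfl⟩ := hB w hw
    refine ⟨y, hy, ω, h1, rfl, ?_⟩
    obtain ⟨u, -, rfl⟩ := hy
    rw [map_add, pie_nabla, zero_add, pie_tmul, evP_PP, one_smul]
  refine ⟨pie, fun z h => ⟨fun h0 => ?_, ?_⟩, le_antisymm ?_ ?_⟩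
  · obtain ⟨y, hy, ω, h1, rfl, h2⟩ := hz z h
    have : ω = 0 := by rw [← psi_phi h1, ← h2, h0, map_zero]
    rw [this, TensorProduct.zero_tmul, add_zero]
    exact hy
  · rintro ⟨u, -, rfl⟩
    exact pie_nabla u
  · rintro _ ⟨z, h, rfl⟩
    obtain ⟨y, hy, ω, h1, h3, h2⟩ := hz z h
    rw [h2]
    exact ⟨ω, h1, rfl⟩
  · rintro _ ⟨ω, h1, rfl⟩
    refine ⟨ω ⊗ₜ PP 1 r s, GD_mem r s 0 h1 (by omega) (by omega)
      (MvPolynomial.isHomogeneous_one _ _) rfl (by omega), ?_⟩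
    rw [pie_tmul, evP_PP, one_smul]
    rfl

def sw : Fin 4 → Fin 4 := ![2, 3, 0, 1]

def sE : Ex →ₐ[ℂ] Ex := ExteriorAlgebra.map (LinearMap.funLeft ℂ ℂ sw)

theorem sE_fp (i : Fin 2) : sE (fp i) = fm i := by
  rw [sE, fp, f, ExteriorAlgebra.map_apply_ι, fm, f]
  congr 1
  ext j
  fin_cases i <;> fin_cases j <;> simp [LinearMap.funLeft_apply, Pi.single_apply, sw]

theorem sE_fm (i : Fin 2) : sE (fm i) = fp i := by
  rw [sE, fm, f, ExteriorAlgebra.map_apply_ι, fp, f]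
  congr 1
  ext j
  fin_cases i <;> fin_cases j <;> simp [LinearMap.funLeft_apply, Pi.single_apply, sw]

def vw : Fin 4 → Fin 4 := ![0, 1, 3, 2]

def sP : P4 →ₐ[ℂ] P4 := MvPolynomial.rename vw

theorem vw_vw : vw ∘ vw = id := by
  ext i; fin_cases i <;> rfl

theorem vw_xin : vw ∘ xin = xin := by
  ext i; fin_cases i <;> rfl

theorem sw_sw : sw ∘ sw = id := by
  ext i; fin_cases i <;> rfl

theorem sP_sP (p : P4) : sP (sP p) = p := by
  rw [sP, MvPolynomial.rename_rename, vw_vw, MvPolynomial.rename_id_apply]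

theorem sE_sE (ω : Ex) : sE (sE ω) = ω := by
  have : sE.comp sE = AlgHom.id ℂ Ex := by
    rw [sE, ExteriorAlgebra.map_comp_map, ← LinearMap.funLeft_comp, sw_sw]
    exact ExteriorAlgebra.map_id
  exact DFunLike.congr_fun this ω

theorem sP_PP (q : MvPolynomial (Fin 2) ℂ) (r s : ℕ) : sP (PP q r s) = PP q s r := by
  simp only [sP, PP, map_mul, map_pow, MvPolynomial.rename_X, MvPolynomial.rename_rename, vw_xin]
  have h2 : vw 2 = 3 := rfl
  have h3 : vw 3 = 2 := rfl
  rw [h2, h3]; ring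

theorem pd_sP (i : Fin 2) (p : P4) : pd (xin i) (sP p) = sP (pd (xin i) p) := by
  have hv : Function.Injective vw := Function.LeftInverse.injective (g := vw) (congrFun vw_vw)
  have := MvPolynomial.pderiv_rename (R := ℂ) hv (xin i) p
  rw [show vw (xin i) = xin i from congrFun vw_xin i] at this
  exact this

def sig : MEx →ₗ[ℂ] MEx := TensorProduct.map sE.toLinearMap sP.toLinearMap

theorem sig_tmul (ω : Ex) (p : P4) : sig (ω ⊗ₜ p) = sE ω ⊗ₜ sP p := rfl

theorem sig_sig (z : MEx) : sig (sig z) = z := by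
  have : sig ∘ₗ sig = LinearMap.id := by
    refine TensorProduct.ext' fun ω p => ?_
    rw [LinearMap.comp_apply, sig_tmul, sig_tmul, sE_sE, sP_sP]; rfl
  exact LinearMap.congr_fun this z

theorem sig_nabla (z : MEx) : sig (nabla z) = nabla (sig z) := by
  have : sig ∘ₗ nabla = nabla ∘ₗ sig := by
    refine TensorProduct.ext' fun ω p => ?_
    have h2 : sP (MvPolynomial.X 2) = MvPolynomial.X 3 := by
      rw [sP, MvPolynomial.rename_X]; rfl
    have h3 : sP (MvPolynomial.X 3) = MvPolynomial.X 2 := by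
      rw [sP, MvPolynomial.rename_X]; rfl
    simp only [LinearMap.comp_apply, sig_tmul, nabla_tmul, map_add, map_mul, sE_fp, sE_fm, h2, h3,
      pd_sP]
    abel
  exact LinearMap.congr_fun this z

theorem sE_AA (lp lm : List (Fin 2)) : sE (AA lp lm) ∈ lamPM lm.length lp.length := by
  induction lp with
  | nil =>
    induction lm with
    | nil => simpa [AA] using AA_mem [] []
    | cons i lm ih =>
      rw [AA_nil_cons, map_mul, sE_fm]
      simpa using fp_mul_mem i ih
  | cons i lp ih =>
    rw [AA_cons, map_mul, sE_fp]
    simpa using fm_mul_mem i ih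

theorem sE_mem {k l : ℤ} {ω : Ex} (h : ω ∈ lamPM k l) : sE ω ∈ lamPM l k := by
  have : lamPM k l ≤ (lamPM l k).comap sE.toLinearMap := by
    refine lamPM_le fun lp lm h1 h2 => ?_
    rw [← h1, ← h2]
    exact sE_AA lp lm
  exact this h

theorem sig_mem {a b m n : ℤ} {z : MEx} (hz : z ∈ GD a b m n) : sig z ∈ GD b a m n := by
  have : GD a b m n ≤ (GD b a m n).comap sig := by
    refine GD_le fun r s d ω q h1 h2 h3 h4 => ?_
    rw [Submodule.mem_comap, sig_tmul, sP_PP]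
    exact GD_mem s r d (sE_mem h1) rfl rfl h2 h3 (by omega)
  exact this hz

theorem sig_im {a b m n : ℤ} {z : MEx} (hz : z ∈ Submodule.map nabla (GD a b m n)) :
    sig z ∈ Submodule.map nabla (GD b a m n) := by
  obtain ⟨u, hu, rfl⟩ := hz
  exact ⟨sig u, sig_mem hu, (sig_nabla u).symm⟩

theorem partA' {a b m n : ℤ} (hb : b ≤ 0) (hm : 0 < m) :
    GD a b m n ⊓ LinearMap.ker nabla ≤ Submodule.map nabla (GD a b (m + 1) (n + 1)) := by
  rintro z ⟨h1, h2⟩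
  have h3 := partA hb hm (show sig z ∈ GD b a m n ⊓ LinearMap.ker nabla from
    ⟨sig_mem h1, by
      have h2' : nabla z = 0 := h2
      change nabla (sig z) = 0
      rw [← sig_nabla, h2', map_zero]⟩)
  have := sig_im h3
  rwa [sig_sig] at this

theorem partB' {a b n : ℤ} (hb : b ≤ 0) (hn : min a b < n) :
    GD a b 0 n ≤ Submodule.map nabla (GD a b 1 (n + 1)) := by
  intro z hz
  have := sig_im (partB hb (by rwa [min_comm]) (sig_mem hz))
  rwa [sig_sig] at this

theorem partC' {a b n : ℤ} (hb : b ≤ 0) (hn : n ≤ min a b) :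
    ∃ π : MEx →ₗ[ℂ] Ex2,
      (∀ z ∈ GD a b 0 n, π z = 0 ↔ z ∈ Submodule.map nabla (GD a b 1 (n + 1))) ∧
      Submodule.map π (GD a b 0 n) = WW (a + b - n) := by
  obtain ⟨π, h1, h2⟩ := partC (a := b) (b := a) (n := n) hb (by rwa [min_comm])
  refine ⟨π ∘ₗ sig, fun z hz => ?_, ?_⟩
  · rw [LinearMap.comp_apply, h1 _ (sig_mem hz)]
    constructor
    · intro h
      have := sig_im h
      rwa [sig_sig] at this
    · exact sig_im
  · rw [add_comm a b, ← h2]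
    apply le_antisymm
    · rintro _ ⟨z, hz, rfl⟩
      exact ⟨sig z, sig_mem hz, rfl⟩
    · rintro _ ⟨z, hz, rfl⟩
      exact ⟨sig z, sig_mem hz, by rw [LinearMap.comp_apply, sig_sig]⟩

theorem finish {S I : Submodule ℂ MEx} {W : Submodule ℂ Ex2} (π : MEx →ₗ[ℂ] Ex2)
    (h1 : ∀ z ∈ S, π z = 0 ↔ z ∈ I) (h2 : Submodule.map π S = W) :
    Nonempty ((↥S ⧸ (Submodule.comap S.subtype I)) ≃ₗ[ℂ] ↥W) := by
  subst h2
  have hk : LinearMap.ker (π.submoduleMap S) = Submodule.comap S.subtype I := by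
    ext z
    rw [LinearMap.mem_ker, Submodule.mem_comap, ← Subtype.coe_inj]
    exact h1 z z.2
  rw [← hk]
  exact ⟨(π.submoduleMap S).quotKerEquivOfSurjective (π.submoduleMap_surjective S)⟩

/-- for integers `a, b` with `a < 0` or `b < 0` and `k = min a b`:
`H^{m,n}(G_D(a,b)) = 0` whenever `m > 0`, or `m = 0` and `n > k`; and for `m = 0`,
`n ≤ k`, `H^{0,n}(G_D(a,b))` is a `ℂ`-vector space of dimension `binom(2, a+b−n)`. -/
theorem homology_GD (a b m n : ℤ) (hab : a < 0 ∨ b < 0) :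
    (0 < m →
      GD a b m n ⊓ LinearMap.ker nabla ≤ Submodule.map nabla (GD a b (m + 1) (n + 1))) ∧
    (m = 0 → min a b < n →
      GD a b m n ⊓ LinearMap.ker nabla ≤ Submodule.map nabla (GD a b (m + 1) (n + 1))) ∧
    (m = 0 → n ≤ min a b →
      Nonempty ((↥(GD a b m n ⊓ LinearMap.ker nabla) ⧸
          (Submodule.comap (GD a b m n ⊓ LinearMap.ker nabla).subtype
            (Submodule.map nabla (GD a b (m + 1) (n + 1))))) ≃ₗ[ℂ]
        (Fin (zbinom (a + b - n)) → ℂ))) := by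
  have hab' : a ≤ 0 ∨ b ≤ 0 := by omega
  refine ⟨fun hm => ?_, fun hm hn => ?_, fun hm hn => ?_⟩
  · rcases hab' with h | h
    · exact partA h hm
    · exact partA' h hm
  · subst hm
    rcases hab' with h | h
    · exact inf_le_left.trans (partB h hn)
    · exact inf_le_left.trans (partB' h hn)
  · subst hm
    have hS : GD a b 0 n ⊓ LinearMap.ker nabla = GD a b 0 n := inf_eq_left.mpr GD_ker
    obtain ⟨π, h1, h2⟩ : ∃ π : MEx →ₗ[ℂ] Ex2,
      (∀ z ∈ GD a b 0 n, π z = 0 ↔ z ∈ Submodule.map nabla (GD a b 1 (n + 1))) ∧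
      Submodule.map π (GD a b 0 n) = WW (a + b - n) := by
      rcases hab' with h | h
      · exact partC h hn
      · exact partC' h hn
    rw [hS]
    obtain ⟨e1⟩ := finish π h1 h2
    obtain ⟨e2⟩ := WW_equiv (a + b - n)
    exact ⟨e1.trans e2⟩

end
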